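/- arXiv:2411.08987 — 2 statements merged into one kernel-verified Lean document; each statement's English description precedes it below -/
import Mathlib

section
/- Let ‖·‖ be a norm on ℝ^d with dual norm ‖·‖_*, let f : ℝ^d → ℝ be convex, and let ψ : ℝ^d → ℝ be differentiable and δ-inexact (μ,r)-uniformly convex with respect to ‖·‖ for some μ > 0, δ ≥ 0, r > 1. Fix σ, σ' ∈ [0, 1/2), set r_* := r/(r−1) and C := (μ/2)·(r_*(1−σ−σ')/(1+σ^{r_*}))^{r−1}. Let x₀ = y₀ = z₀ ∈ ℝ^d, A₀ = 0, and suppose that for each k = 1,…,T there are λ_k > 0, a_k > 0, ε_k ≥ 0 and points x_k, y_k, z_k, v_k ∈ ℝ^d satisfying: a_k^r = C·(A_{k−1}+a_k)^{r−1}·λ_k with A_k := A_{k−1} + a_k; x_k = (A_{k−1}/A_k)·y_{k−1} + (a_k/A_k)·z_{k−1}; v_k is an ε_k-enlarged subgradient of f at y_k (i.e. f(z) ≥ f(y_k) + ⟨v_k, z−y_k⟩ − ε_k for all z) with ε_k ≤ (σ'/λ_k)‖x_k−y_k‖^r; there exists v̂_k such that −v̂_k is a subgradient of z ↦ (1/(rλ_k))‖z−x_k‖^r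 at y_k and ‖v_k − v̂_k‖_* ≤ (σ/λ_k)‖x_k−y_k‖^{r−1}; and z_k is a global minimizer of z ↦ Σ_{i=1}^k a_i⟨v_i, z⟩ + D_ψ(z, x₀). Then for every u ∈ ℝ^d: f(y_T) − f(u) ≤ r^r·(D_ψ(u,x₀) + δT) / (C·(Σ_{k=1}^T λ_k^{1/r})^r). -/
open Finset

/-- Bregman divergence of a differentiable function `ψ`:
`D_ψ(x,y) = ψ(x) − ψ(y) − ⟨∇ψ(y), x−y⟩`. -/
noncomputable def breg {d : ℕ} (ψ : (Fin d → ℝ) → ℝ) (x y : Fin d → ℝ) : ℝ :=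
  ψ x - ψ y - fderiv ℝ ψ y (x - y)

/-- The dual norm of a norm `N` on `ℝ^d`: `‖g‖_* = sup{⟨g,u⟩ : ‖u‖ ≤ 1}`. -/
noncomputable def dualNorm {d : ℕ} (N : (Fin d → ℝ) → ℝ) (g : Fin d → ℝ) : ℝ :=
  sSup ((fun u : Fin d → ℝ => ∑ i, g i * u i) '' {u | N u ≤ 1})

/-- The linear functional `u ↦ ⟨g,u⟩`. -/
noncomputable def dotL {d : ℕ} (g : Fin d → ℝ) : (Fin d → ℝ) →ₗ[ℝ] ℝ :=
  ∑ i, g i • LinearMap.proj i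

lemma dotL_apply {d : ℕ} (g u : Fin d → ℝ) : dotL g u = ∑ i, g i * u i := by
  simp [dotL]

lemma lin_bound {E : Type*} [AddCommGroup E] [Module ℝ E] [FiniteDimensional ℝ E]
    (N : E → ℝ) (h1 : ∀ x y, N (x + y) ≤ N x + N y)
    (h2 : ∀ (a : ℝ) (x : E), N (a • x) = |a| * N x)
    (h3 : ∀ x, N x = 0 ↔ x = 0) (l : E →ₗ[ℝ] ℝ) : ∃ K : ℝ, 0 ≤ K ∧ ∀ u, l u ≤ K * N u := by
  let n : AddGroupNorm E :=
    { toFun := N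
      map_zero' := (h3 0).2 rfl
      add_le' := h1
      neg' := fun x => by have := h2 (-1) x; simpa using this
      eq_zero_of_map_eq_zero' := fun x hx => (h3 x).1 hx }
  letI : NormedAddCommGroup E := n.toNormedAddCommGroup
  letI : NormedSpace ℝ E := { norm_smul_le := fun a x => (h2 a x).le }
  refine ⟨‖LinearMap.toContinuousLinearMap l‖, norm_nonneg _, fun u => ?_⟩
  have := (LinearMap.toContinuousLinearMap l).le_opNorm u
  exact (le_abs_self _).trans this

lemma N_nonneg {E : Type*} [AddCommGroup E] [Module ℝ E]
    (N : E → ℝ) (h1 : ∀ x y, N (x + y) ≤ N x + N y)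
    (h2 : ∀ (a : ℝ) (x : E), N (a • x) = |a| * N x) (x : E) : 0 ≤ N x := by
  have e1 := h2 (-1) x
  have e2 := h1 x (-x)
  have e3 := h2 0 x
  simp at e1 e2 e3
  linarith

lemma dual_le {d : ℕ} (N : (Fin d → ℝ) → ℝ) (h1 : ∀ x y, N (x + y) ≤ N x + N y)
    (h2 : ∀ (a : ℝ) (x : Fin d → ℝ), N (a • x) = |a| * N x)
    (h3 : ∀ x, N x = 0 ↔ x = 0) (g u : Fin d → ℝ) : dotL g u ≤ dualNorm N g * N u := by
  obtain ⟨K, hK0, hK⟩ := lin_bound N h1 h2 h3 (dotL g)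
  by_cases hu : N u = 0
  · rw [hu, (h3 u).1 hu]; simp
  have hpos : 0 < N u := lt_of_le_of_ne (N_nonneg N h1 h2 u) (Ne.symm hu)
  have hb : dotL g ((N u)⁻¹ • u) ≤ dualNorm N g := by
    apply le_csSup
    · refine ⟨K, ?_⟩
      rintro _ ⟨w, hw, rfl⟩
      have := hK w
      rw [dotL_apply] at this
      have hw' : N w ≤ 1 := hw
      exact this.trans (by nlinarith)
    · refine ⟨(N u)⁻¹ • u, ?_, (dotL_apply _ _).symm⟩
      change N ((N u)⁻¹ • u) ≤ 1
      rw [h2, abs_of_pos (inv_pos.2 hpos), inv_mul_cancel₀ hu]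
  rw [map_smul, smul_eq_mul, inv_mul_le_iff₀ hpos] at hb
  linarith

lemma slope_lem (R b r lam c : ℝ) (hr : 1 < r) (hlam : 0 < lam)
    (h : ∀ t : ℝ, 0 < t → t < 1 →
      1 / (r * lam) * R ^ r + t * c ≤ 1 / (r * lam) * (R + t * b) ^ r) :
    c ≤ R ^ (r - 1) / lam * b := by
  have hd : HasDerivAt (fun t : ℝ => 1 / (r * lam) * (R + t * b) ^ r)
      (1 / (r * lam) * (b * r * (R + 0 * b) ^ (r - 1))) 0 := by
    apply HasDerivAt.const_mul
    have : HasDerivAt (fun t : ℝ => R + t * b) b 0 := by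
      simpa using ((hasDerivAt_id (0:ℝ)).mul_const b).const_add R
    exact this.rpow_const (Or.inr hr.le)
  have h2 := hd.tendsto_slope_zero_right
  have h3 : 1 / (r * lam) * (b * r * (R + 0 * b) ^ (r - 1)) = R ^ (r - 1) / lam * b := by
    have : r ≠ 0 := by linarith
    simp only [zero_mul, add_zero]
    field_simp
  rw [h3] at h2
  refine ge_of_tendsto h2 ?_
  have : Set.Ioo (0:ℝ) 1 ∈ nhdsWithin (0:ℝ) (Set.Ioi 0) := Ioo_mem_nhdsGT one_pos
  filter_upwards [this] with t ht
  have := h t ht.1 ht.2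
  simp only [zero_add, zero_mul, add_zero, smul_eq_mul]
  rw [le_inv_mul_iff₀ ht.1]
  linarith

lemma pm (σ r s : ℝ) (hσ : 0 ≤ σ) (hr : 1 < r) (hs : s = r / (r - 1)) :
    (1 + σ) ^ r ≤ 2 * (1 + σ ^ s) ^ (r - 1) := by
  have hr1 : 0 < r - 1 := by linarith
  have hs1 : 1 ≤ s := by rw [hs, le_div_iff₀ hr1]; linarith
  have h := NNReal.rpow_add_le_mul_rpow_add_rpow 1 σ.toNNReal hs1
  have h' : (1 + σ) ^ s ≤ 2 ^ (s - 1) * (1 + σ ^ s) := by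
    have h2 := NNReal.coe_le_coe.2 h
    rw [NNReal.coe_rpow, NNReal.coe_mul, NNReal.coe_rpow, NNReal.coe_add, NNReal.coe_add,
      NNReal.coe_rpow, NNReal.coe_rpow, Real.coe_toNNReal σ hσ] at h2
    simpa using h2
  have h3 := Real.rpow_le_rpow (by positivity) h' hr1.le
  rw [Real.mul_rpow (by positivity) (by positivity), ← Real.rpow_mul (by positivity),
    ← Real.rpow_mul (by positivity)] at h3
  have e1 : s * (r - 1) = r := by rw [hs]; field_simp
  have e2 : (s - 1) * (r - 1) = 1 := by rw [sub_mul, e1]; ring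
  rwa [e1, e2, Real.rpow_one] at h3

lemma young_step (μ r s A a lam σ σ' C R n : ℝ) (hμ : 0 < μ) (hr : 1 < r)
    (hs : s = r / (r - 1)) (hA : 0 < A) (ha : 0 < a) (hlam : 0 < lam)
    (hσ : 0 ≤ σ) (hσσ : 0 < 1 - σ - σ')
    (hC : C = μ / 2 * (s * (1 - σ - σ') / (1 + σ ^ s)) ^ (r - 1))
    (haeq : a ^ r = C * A ^ (r - 1) * lam) (hR : 0 ≤ R) (hn : 0 ≤ n) :
    a * ((1 + σ) / lam * R ^ (r - 1) * n) ≤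
      μ / r * n ^ r + A * ((1 - σ - σ') / lam * R ^ r) := by
  have hr1 : 0 < r - 1 := by linarith
  have hr0 : 0 < r := by linarith
  have hspos : 0 < s := by rw [hs]; positivity
  have hσs : 0 < 1 + σ ^ s := by positivity
  have hrs : r.HolderConjugate s := by
    rw [hs]; exact Real.HolderConjugate.conjExponent hr
  set S := A * ((1 - σ - σ') / lam) * s with hS
  have hSpos : 0 < S := by positivity
  have hy := Real.young_inequality_of_nonneg (a := μ ^ (1 / r) * n)
    (b := S ^ (1 / s) * R ^ (r - 1)) (by positivity) (by positivity) hrs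
  have e1 : (μ ^ (1 / r) * n) ^ r = μ * n ^ r := by
    rw [Real.mul_rpow (by positivity) hn, ← Real.rpow_mul hμ.le, one_div_mul_cancel hr0.ne',
      Real.rpow_one]
  have e2 : (S ^ (1 / s) * R ^ (r - 1)) ^ s = S * R ^ r := by
    rw [Real.mul_rpow (by positivity) (by positivity), ← Real.rpow_mul hSpos.le,
      one_div_mul_cancel hspos.ne', Real.rpow_one, ← Real.rpow_mul hR]
    congr 2
    rw [hs]; field_simp
  rw [e1, e2] at hy
  have e3 : S * R ^ r / s = A * ((1 - σ - σ') / lam * R ^ r) := by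
    rw [hS]; field_simp
  rw [e3] at hy
  have key : a * (1 + σ) / lam ≤ μ ^ (1 / r) * S ^ (1 / s) := by
    rw [← Real.rpow_le_rpow_iff (by positivity) (by positivity) hr0]
    have e4 : (μ ^ (1 / r) * S ^ (1 / s)) ^ r = μ * S ^ (r - 1) := by
      rw [Real.mul_rpow (by positivity) (by positivity), ← Real.rpow_mul hμ.le,
        one_div_mul_cancel hr0.ne', Real.rpow_one, ← Real.rpow_mul hSpos.le]
      congr 2
      rw [hs]; field_simp
    have e5 : S ^ (r - 1) = A ^ (r - 1) * (s * (1 - σ - σ')) ^ (r - 1) / lam ^ (r - 1) := by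
      rw [← Real.mul_rpow (by positivity) (by positivity),
        ← Real.div_rpow (by positivity) (by positivity)]
      congr 1
      rw [hS]; field_simp
    have e6 : lam ^ r = lam ^ (r - 1) * lam := by
      rw [← Real.rpow_add_one hlam.ne']; congr 1; ring
    have hp := pm σ r s hσ hr hs
    rw [e4, e5, Real.div_rpow (by positivity) hlam.le, Real.mul_rpow ha.le (by positivity),
      haeq, e6, hC, Real.div_rpow (by positivity) hσs.le]
    have q1 : 0 < (1 + σ ^ s) ^ (r - 1) := by positivity
    have q2 : 0 < lam ^ (r - 1) := by positivity
    have q3 : 0 < A ^ (r - 1) := by positivity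
    have q4 : 0 < (s * (1 - σ - σ')) ^ (r - 1) := by positivity
    generalize (1 + σ ^ s) ^ (r - 1) = Q1 at *
    generalize lam ^ (r - 1) = Q2 at *
    generalize A ^ (r - 1) = Q3 at *
    generalize (s * (1 - σ - σ')) ^ (r - 1) = Q4 at *
    generalize (1 + σ) ^ r = Q5 at *
    have : μ / 2 * (Q4 / Q1) * Q3 * lam * Q5 / (Q2 * lam) = (μ * Q4 * Q3 / Q2) * (Q5 / (2 * Q1)) := by
      field_simp
    rw [this]
    have h1 : Q5 / (2 * Q1) ≤ 1 := by rw [div_le_one (by positivity)]; exact hp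
    calc _ ≤ (μ * Q4 * Q3 / Q2) * 1 := by gcongr
      _ = _ := by ring
  calc _ = a * (1 + σ) / lam * (R ^ (r - 1) * n) := by ring
    _ ≤ μ ^ (1 / r) * S ^ (1 / s) * (R ^ (r - 1) * n) := by gcongr
    _ = μ ^ (1 / r) * n * (S ^ (1 / s) * R ^ (r - 1)) := by ring
    _ ≤ _ := hy
    _ = _ := by ring

lemma growth (A0 A1 a r C lam : ℝ) (hr : 1 < r) (hA0 : 0 ≤ A0) (ha : 0 < a) (hlam : 0 < lam)
    (hC : 0 < C) (hA : A1 = A0 + a) (haeq : a ^ r = C * A1 ^ (r - 1) * lam) :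
    A0 ^ (1 / r) + C ^ (1 / r) / r * lam ^ (1 / r) ≤ A1 ^ (1 / r) := by
  have hr0 : 0 < r := by linarith
  have hA1 : 0 < A1 := by linarith
  have e : a = C ^ (1 / r) * A1 ^ (1 - 1 / r) * lam ^ (1 / r) := by
    have : a = (a ^ r) ^ (1 / r) := by
      rw [← Real.rpow_mul ha.le, mul_one_div_cancel hr0.ne', Real.rpow_one]
    rw [this, haeq, Real.mul_rpow (by positivity) hlam.le, Real.mul_rpow hC.le (by positivity),
      ← Real.rpow_mul hA1.le]
    congr 3
    field_simp
  have hb := rpow_one_add_le_one_add_mul_self (s := A0 / A1 - 1) (p := 1 / r)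
    (by have : 0 ≤ A0 / A1 := by positivity
        linarith) (by positivity) (by rw [div_le_one hr0]; exact hr.le)
  have e1 : (1 + (A0 / A1 - 1)) = A0 / A1 := by ring
  rw [e1, Real.div_rpow hA0 hA1.le, div_le_iff₀ (by positivity)] at hb
  have e2 : A0 / A1 - 1 = - (a / A1) := by rw [hA]; field_simp; ring
  have e3 : a / A1 * A1 ^ (1 / r) = C ^ (1 / r) * lam ^ (1 / r) := by
    nth_rewrite 1 [e]
    rw [Real.rpow_sub hA1, Real.rpow_one]
    have : A1 ^ (1 / r) ≠ 0 := by positivity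
    field_simp
  rw [e2] at hb
  have e4 : (1 + 1 / r * -(a / A1)) * A1 ^ (1 / r) =
      A1 ^ (1 / r) - 1 / r * (a / A1 * A1 ^ (1 / r)) := by ring
  rw [e4, e3] at hb
  have : C ^ (1 / r) / r * lam ^ (1 / r) = 1 / r * (C ^ (1 / r) * lam ^ (1 / r)) := by ring
  linarith

lemma three_point {d : ℕ} (ψ : (Fin d → ℝ) → ℝ) (hψ : Differentiable ℝ ψ)
    (L : (Fin d → ℝ) →ₗ[ℝ] ℝ) (x0 z : Fin d → ℝ)
    (h : ∀ w, L z + breg ψ z x0 ≤ L w + breg ψ w x0) (w : Fin d → ℝ) :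
    L w + breg ψ w x0 = L z + breg ψ z x0 + breg ψ w z := by
  let L' := LinearMap.toContinuousLinearMap L
  have hL : ∀ w, L' w = L w := fun _ => rfl
  have hd : HasFDerivAt (fun w => L' w + breg ψ w x0)
      (L' + (fderiv ℝ ψ z - fderiv ℝ ψ x0)) z := by
    unfold breg
    apply HasFDerivAt.add L'.hasFDerivAt
    apply HasFDerivAt.sub ((hψ z).hasFDerivAt.sub_const _)
    exact (fderiv ℝ ψ x0).hasFDerivAt.comp z ((hasFDerivAt_id z).sub_const x0)
  have hm : IsLocalMin (fun w => L' w + breg ψ w x0) z := Filter.Eventually.of_forall h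
  have h0 := hm.hasFDerivAt_eq_zero hd
  have h1 := DFunLike.congr_fun h0 (w - z)
  simp only [add_apply, sub_apply, hL,
    zero_apply] at h1
  unfold breg
  simp only [map_sub] at h1 ⊢
  linarith

/-- Convergence of the non-Euclidean accelerated inexact proximal point method with a
`δ`-inexact `(μ,r)`-uniformly convex regularizer: for every `u`,
`f(y_T) − f(u) ≤ r^r·(D_ψ(u,x₀) + δT) / (C·(Σ_{k=1}^T λ_k^{1/r})^r)`. -/
theorem stmt8 {d : ℕ} (N : (Fin d → ℝ) → ℝ)
    (hN_triangle : ∀ x y, N (x + y) ≤ N x + N y)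
    (hN_smul : ∀ (a : ℝ) (x : Fin d → ℝ), N (a • x) = |a| * N x)
    (hN_def : ∀ x, N x = 0 ↔ x = 0)
    (f : (Fin d → ℝ) → ℝ) (hf : ConvexOn ℝ Set.univ f)
    (ψ : (Fin d → ℝ) → ℝ) (hψdiff : Differentiable ℝ ψ)
    (μ δ r : ℝ) (hμ : 0 < μ) (hδ : 0 ≤ δ) (hr : 1 < r)
    (hψuc : ∀ x y, breg ψ x y ≥ μ / r * N (x - y) ^ r - δ)
    (σ σ' : ℝ) (hσ0 : 0 ≤ σ) (hσ : σ < 1 / 2) (hσ'0 : 0 ≤ σ') (hσ' : σ' < 1 / 2)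
    (rstar C : ℝ) (hrstar : rstar = r / (r - 1))
    (hC : C = μ / 2 * (rstar * (1 - σ - σ') / (1 + σ ^ rstar)) ^ (r - 1))
    (T : ℕ) (hT : 1 ≤ T)
    (x y z v : ℕ → Fin d → ℝ) (lam a ε : ℕ → ℝ) (A : ℕ → ℝ)
    (hA0 : A 0 = 0) (hx0 : x 0 = y 0) (hz0 : z 0 = y 0)
    (hlam : ∀ k, 1 ≤ k → k ≤ T → 0 < lam k)
    (ha : ∀ k, 1 ≤ k → k ≤ T → 0 < a k)
    (hεnn : ∀ k, 1 ≤ k → k ≤ T → 0 ≤ ε k)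
    (hA : ∀ k, 1 ≤ k → k ≤ T → A k = A (k - 1) + a k)
    (haeq : ∀ k, 1 ≤ k → k ≤ T →
      a k ^ r = C * (A (k - 1) + a k) ^ (r - 1) * lam k)
    (hx : ∀ k, 1 ≤ k → k ≤ T →
      x k = (A (k - 1) / A k) • y (k - 1) + (a k / A k) • z (k - 1))
    (hv : ∀ k, 1 ≤ k → k ≤ T →
      ∀ w, f w ≥ f (y k) + (∑ i, v k i * (w - y k) i) - ε k)
    (hε : ∀ k, 1 ≤ k → k ≤ T → ε k ≤ σ' / lam k * N (x k - y k) ^ r)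
    (hvhat : ∀ k, 1 ≤ k → k ≤ T → ∃ vhat : Fin d → ℝ,
      (∀ w, (1 / (r * lam k)) * N (w - x k) ^ r ≥
        (1 / (r * lam k)) * N (y k - x k) ^ r + ∑ i, (-vhat) i * (w - y k) i) ∧
      dualNorm N (v k - vhat) ≤ σ / lam k * N (x k - y k) ^ (r - 1))
    (hz : ∀ k, 1 ≤ k → k ≤ T → ∀ w,
      (∑ i ∈ Icc 1 k, a i * ∑ j, v i j * z k j) + breg ψ (z k) (x 0) ≤
        (∑ i ∈ Icc 1 k, a i * ∑ j, v i j * w j) + breg ψ w (x 0)) :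
    ∀ u, f (y T) - f u ≤
      r ^ r * (breg ψ u (x 0) + δ * T) /
        (C * (∑ k ∈ Icc 1 T, lam k ^ (1 / r)) ^ r) := by
  have hNnn := N_nonneg N hN_triangle hN_smul
  have hr0 : 0 < r := by linarith
  have hr1 : 0 < r - 1 := by linarith
  have hσσ : 0 < 1 - σ - σ' := by linarith
  have hspos : 0 < rstar := by rw [hrstar]; positivity
  have hCpos : 0 < C := by rw [hC]; positivity
  have hAnn : ∀ k, k ≤ T → 0 ≤ A k := by
    intro k
    induction k with
    | zero => intro _; rw [hA0]
    | succ k ih =>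
      intro hk
      rw [hA (k + 1) (by omega) hk]
      have := ih (by omega)
      have := ha (k + 1) (by omega) hk
      simp only [Nat.add_sub_cancel]
      linarith
  -- growth of `A`
  have hgrow : ∀ k, k ≤ T →
      C ^ (1 / r) / r * ∑ i ∈ Icc 1 k, lam i ^ (1 / r) ≤ A k ^ (1 / r) := by
    intro k
    induction k with
    | zero => intro _; simp [hA0]; positivity
    | succ k ih =>
      intro hk
      have h1 := ih (by omega)
      have h2 := hA (k + 1) (by omega) hk
      have h3 := haeq (k + 1) (by omega) hk
      simp only [Nat.add_sub_cancel] at h2 h3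
      rw [← h2] at h3
      have h4 := growth (A k) (A (k + 1)) (a (k + 1)) r C (lam (k + 1)) hr (hAnn k (by omega))
        (ha (k + 1) (by omega) hk) (hlam (k + 1) (by omega) hk) hCpos h2 h3
      rw [Finset.sum_Icc_succ_top (by omega), mul_add]
      linarith
  -- the estimate sequence
  let L : ℕ → (Fin d → ℝ) →ₗ[ℝ] ℝ := fun k => ∑ i ∈ Icc 1 k, a i • dotL (v i)
  have hL : ∀ k w, L k w = ∑ i ∈ Icc 1 k, a i * ∑ j, v i j * w j := by
    intro k w
    simp [L, dotL_apply]
  have hLs : ∀ k w, L (k + 1) w = L k w + a (k + 1) * dotL (v (k + 1)) w := by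
    intro k w
    simp only [L]
    rw [Finset.sum_Icc_succ_top (by omega)]
    simp
  have htp : ∀ k, k ≤ T → ∀ w,
      L k w + breg ψ w (x 0) = L k (z k) + breg ψ (z k) (x 0) + breg ψ w (z k) := by
    intro k hk w
    rcases Nat.eq_zero_or_pos k with rfl | hk0
    · rw [hz0, ← hx0]
      simp [L, breg]
    · apply three_point ψ hψdiff
      intro w
      rw [hL, hL]
      exact hz k hk0 hk w
  have hmain : ∀ k, k ≤ T → A k * f (y k) ≤
      ∑ i ∈ Icc 1 k, a i * (f (y i) - dotL (v i) (y i) - ε i) + L k (z k)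
        + breg ψ (z k) (x 0) + k * δ := by
    intro k
    induction k with
    | zero => 
      intro _
      rw [hz0, ← hx0]
      simp [L, breg, hA0]
    | succ k ih =>
      intro hk
      have hk1 : 1 ≤ k + 1 := by omega
      have ih' := ih (by omega)
      have hAk := hAnn k (by omega)
      have hak := ha _ hk1 hk
      have hlk := hlam _ hk1 hk
      have hAs := hA _ hk1 hk
      have hae := haeq _ hk1 hk
      have hxk := hx _ hk1 hk
      have hεk := hε _ hk1 hk
      have hvk := hv _ hk1 hk (y k)
      obtain ⟨vh, hvh1, hvh2⟩ := hvhat _ hk1 hk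
      have htpk := htp k (by omega) (z (k + 1))
      have huc := hψuc (z (k + 1)) (z k)
      simp only [Nat.add_sub_cancel] at hAs hae hxk
      rw [← hAs] at hae
      rw [← dotL_apply] at hvk
      rw [Finset.sum_Icc_succ_top (by omega), hLs]
      have hAp : 0 < A (k + 1) := by linarith
      -- bounds for the subgradient
      set R := N (x (k + 1) - y (k + 1)) with hR
      set n := N (z (k + 1) - z k) with hn
      have hNneg : ∀ u, N (-u) = N u := fun u => by simpa using hN_smul (-1) u
      have hR' : N (y (k + 1) - x (k + 1)) = R := by rw [hR, ← hNneg, neg_sub]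
      have hRnn : 0 ≤ R := hNnn _
      have hnnn : 0 ≤ n := hNnn _
      have hsub : ∀ (q : Fin d → ℝ) (b : ℝ),
          (∀ t : ℝ, 0 < t → t < 1 → N (y (k + 1) - x (k + 1) - t • q) ≤ R + t * b) →
          dotL vh q ≤ R ^ (r - 1) / lam (k + 1) * b := by
        intro q b hq
        apply slope_lem R b r (lam (k + 1)) _ hr hlk
        intro t ht0 ht1
        have h1 := hvh1 (y (k + 1) - t • q)
        have e1 : y (k + 1) - t • q - x (k + 1) = y (k + 1) - x (k + 1) - t • q := by abel
        have e2 : ∑ i, (-vh) i * (y (k + 1) - t • q - y (k + 1)) i = t * dotL vh q := by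
          rw [dotL_apply, Finset.mul_sum]
          apply Finset.sum_congr rfl
          intro i _
          simp
          ring
        rw [e1, e2, hR'] at h1
        refine h1.trans ?_
        have := hNnn (y (k + 1) - x (k + 1) - t • q)
        have := hq t ht0 ht1
        gcongr
      have hs1 := hsub (y (k + 1) - x (k + 1)) (-R) (by
        intro t ht0 ht1
        have : y (k + 1) - x (k + 1) - t • (y (k + 1) - x (k + 1)) =
            (1 - t) • (y (k + 1) - x (k + 1)) := by rw [sub_smul, one_smul]
        rw [this, hN_smul, hR', abs_of_pos (by linarith)]
        linarith)
      have hs2 := hsub (-(z (k + 1) - z k)) n (by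
        intro t ht0 ht1
        have h1 := hN_triangle (y (k + 1) - x (k + 1)) (t • (z (k + 1) - z k))
        rw [hN_smul, hR', abs_of_pos ht0] at h1
        rw [smul_neg, sub_neg_eq_add]
        exact h1)
      have hdl : ∀ u, dotL (v (k + 1) - vh) u ≤
          σ / lam (k + 1) * R ^ (r - 1) * N u := by
        intro u
        refine (dual_le N hN_triangle hN_smul hN_def _ u).trans ?_
        exact mul_le_mul_of_nonneg_right hvh2 (hNnn u)
      have hdsub : ∀ u, dotL (v (k + 1) - vh) u = dotL (v (k + 1)) u - dotL vh u := by
        intro u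
        simp only [dotL_apply, ← Finset.sum_sub_distrib, Pi.sub_apply, sub_mul]
      have hd1 := hdl (y (k + 1) - x (k + 1))
      have hd2 := hdl (-(z (k + 1) - z k))
      rw [hdsub, hR'] at hd1
      rw [hdsub, hNneg] at hd2
      have hRr : R ^ (r - 1) * R = R ^ r := by
        rcases hRnn.eq_or_lt with h0 | h0
        · rw [← h0, Real.zero_rpow hr0.ne']; simp
        · rw [← Real.rpow_add_one h0.ne']; congr 1; ring
      have hb1 : (1 - σ) / lam (k + 1) * R ^ r ≤
          dotL (v (k + 1)) (x (k + 1) - y (k + 1)) := by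
        rw [← hRr]
        rw [← neg_sub (y (k + 1)) (x (k + 1)), map_neg]
        have : (1 - σ) / lam (k + 1) * (R ^ (r - 1) * R) =
          -(R ^ (r - 1) / lam (k + 1) * (-R)) - σ / lam (k + 1) * R ^ (r - 1) * R := by ring
        linarith
      have hb2 : -((1 + σ) / lam (k + 1) * R ^ (r - 1) * n) ≤
          dotL (v (k + 1)) (z (k + 1) - z k) := by
        rw [map_neg] at hs2 hd2
        rw [map_neg] at hd2
        have : (1 + σ) / lam (k + 1) * R ^ (r - 1) * n =
          R ^ (r - 1) / lam (k + 1) * n + σ / lam (k + 1) * R ^ (r - 1) * n := by ring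
        linarith
      have hyg := young_step μ r rstar (A (k + 1)) (a (k + 1)) (lam (k + 1)) σ σ' C R n hμ hr
        hrstar hAp hak hlk hσ0 hσσ hC hae hRnn hnnn
      have hxA : A (k + 1) • x (k + 1) = A k • y k + a (k + 1) • z k := by
        rw [hxk, smul_add, smul_smul, smul_smul, mul_div_cancel₀ _ hAp.ne',
          mul_div_cancel₀ _ hAp.ne']
      have hxA' := congrArg (dotL (v (k + 1))) hxA
      simp only [map_add, map_smul, smul_eq_mul] at hxA'
      rw [map_sub] at hb1 hb2 hvk
      have m1 := mul_le_mul_of_nonneg_left hb1 hAp.le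
      have m2 := mul_le_mul_of_nonneg_left hb2 hak.le
      have m3 := mul_le_mul_of_nonneg_left hvk hAk
      have m4 := mul_le_mul_of_nonneg_left hεk hAp.le
      have e5 : A (k + 1) * ((1 - σ) / lam (k + 1) * R ^ r) =
          A (k + 1) * ((1 - σ - σ') / lam (k + 1) * R ^ r) +
          A (k + 1) * (σ' / lam (k + 1) * R ^ r) := by ring
      have e6 : A (k + 1) * ε (k + 1) = A k * ε (k + 1) + a (k + 1) * ε (k + 1) := by
        rw [hAs]; ring
      have e7 : A (k + 1) * f (y (k + 1)) = A k * f (y (k + 1)) + a (k + 1) * f (y (k + 1)) := by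
        rw [hAs]; ring
      have e8 : A (k + 1) * dotL (v (k + 1)) (y (k + 1)) =
          A k * dotL (v (k + 1)) (y (k + 1)) + a (k + 1) * dotL (v (k + 1)) (y (k + 1)) := by
        rw [hAs]; ring
      push_cast
      linarith
  intro u
  have hT' := hmain T le_rfl
  have hmin := hz T hT le_rfl u
  rw [← hL, ← hL] at hmin
  have hAsum : ∀ k, k ≤ T → A k = ∑ i ∈ Icc 1 k, a i := by
    intro k
    induction k with
    | zero => intro _; simp [hA0]
    | succ k ih =>
      intro hk
      rw [Finset.sum_Icc_succ_top (by omega), ← ih (by omega), hA (k + 1) (by omega) hk]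
      simp
  have hup : ∑ i ∈ Icc 1 T, a i * (f (y i) - dotL (v i) (y i) - ε i) + L T u ≤ A T * f u := by
    rw [hAsum T le_rfl, hL, ← Finset.sum_add_distrib, Finset.sum_mul]
    apply Finset.sum_le_sum
    intro i hi
    rw [Finset.mem_Icc] at hi
    have h1 := hv i hi.1 hi.2 u
    rw [← dotL_apply, map_sub] at h1
    rw [← dotL_apply, ← mul_add]
    apply mul_le_mul_of_nonneg_left _ (ha i hi.1 hi.2).le
    linarith
  have hfin : A T * (f (y T) - f u) ≤ breg ψ u (x 0) + δ * T := by
    rw [mul_sub]; linarith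
  have hDnn : 0 ≤ breg ψ u (x 0) + δ * T := by
    have h1 := hψuc u (x 0)
    have h2 : 0 ≤ μ / r * N (u - x 0) ^ r := by
      have := hNnn (u - x 0)
      positivity
    have h3 : (1 : ℝ) ≤ T := by exact_mod_cast hT
    nlinarith
  have hSpos : 0 < ∑ k ∈ Icc 1 T, lam k ^ (1 / r) := by
    apply Finset.sum_pos
    · intro i hi
      rw [Finset.mem_Icc] at hi
      exact Real.rpow_pos_of_pos (hlam i hi.1 hi.2) _
    · exact ⟨1, by simp [hT]⟩
  have hg := hgrow T le_rfl
  generalize (∑ k ∈ Icc 1 T, lam k ^ (1 / r)) = S at *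
  have hATnn := hAnn T le_rfl
  have hg2 := Real.rpow_le_rpow (by positivity) hg hr0.le
  rw [← Real.rpow_mul hATnn, one_div_mul_cancel hr0.ne', Real.rpow_one,
    Real.mul_rpow (by positivity) hSpos.le, Real.div_rpow (by positivity) hr0.le,
    ← Real.rpow_mul hCpos.le, one_div_mul_cancel hr0.ne', Real.rpow_one] at hg2
  have hSr : 0 < S ^ r := by positivity
  have hrr : 0 < r ^ r := by positivity
  have hATpos : 0 < A T := lt_of_lt_of_le (by positivity) hg2
  rw [le_div_iff₀ (by positivity)]
  have hg3 : C * S ^ r ≤ r ^ r * A T := by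
    have := mul_le_mul_of_nonneg_left hg2 hrr.le
    calc C * S ^ r = r ^ r * (C / r ^ r * S ^ r) := by field_simp
      _ ≤ _ := this
  by_cases hneg : 0 ≤ f (y T) - f u
  · calc (f (y T) - f u) * (C * S ^ r) ≤ (f (y T) - f u) * (r ^ r * A T) := by gcongr
      _ = r ^ r * (A T * (f (y T) - f u)) := by ring
      _ ≤ _ := by gcongr
  · push Not at hneg
    have h1 : (f (y T) - f u) * (C * S ^ r) ≤ 0 :=
      mul_nonpos_of_nonpos_of_nonneg hneg.le (by positivity)
    exact h1.trans (by positivity)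
end

section
/- Let p ∈ [1,∞], let d ≥ 1, let G > 0, β > 0, and let f : ℝ^d → ℝ be G-Lipschitz with respect to ‖·‖_p. Then the randomized smoothing S_β[f] is G-Lipschitz with respect to ‖·‖_p, is differentiable on ℝ^d, and its gradient satisfies ‖∇S_β[f](x) − ∇S_β[f](y)‖_{p_*} ≤ (dG/β)·‖x−y‖_p for all x, y ∈ ℝ^d, where p_* = (1−1/p)^{−1} is the conjugate exponent of p. -/
open MeasureTheory ENNReal

/-- The ℓ_p norm on `ℝ^d` for `p ∈ [1,∞]`. -/
noncomputable def pNorm {d : ℕ} (p : ℝ≥0∞) (x : Fin d → ℝ) : ℝ :=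
  if p = ∞ then ⨆ i, |x i| else (∑ i, |x i| ^ p.toReal) ^ (1 / p.toReal)

/-- Randomized smoothing: `S_β[f](x) = E_{v ∼ ν(B^p_β)}[f(x+v)]`, the average of `f`
over the closed ℓ_p ball of radius `β` centered at `x`. -/
noncomputable def smoothing {d : ℕ} (p : ℝ≥0∞) (β : ℝ)
    (f : (Fin d → ℝ) → ℝ) (x : Fin d → ℝ) : ℝ :=
  ⨍ v in {v : Fin d → ℝ | pNorm p v ≤ β}, f (x + v)

/-- The gradient of `F : ℝ^d → ℝ` as a vector. -/
noncomputable def grad {d : ℕ} (F : (Fin d → ℝ) → ℝ) (x : Fin d → ℝ) : Fin d → ℝ :=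
  fun i => fderiv ℝ F x (Pi.single i 1)

lemma abs_setInt_le {d : ℕ} (S : Set (Fin d → ℝ)) (g : (Fin d → ℝ) → ℝ) (M : ℝ)
    (hS : volume S < ∞) (h : ∀ x, |g x| ≤ M) : |∫ w in S, g w| ≤ M * volume.real S := by
  have := norm_setIntegral_le_of_norm_le_const (μ := volume) (f := g) (C := M) hS
    (fun z _ => by rw [Real.norm_eq_abs]; exact h z)
  rwa [Real.norm_eq_abs] at this

structure GoodNorm {d : ℕ} (N : (Fin d → ℝ) → ℝ) : Prop where
  tri : ∀ x y, N (x + y) ≤ N x + N y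
  smul : ∀ (c : ℝ) x, N (c • x) = |c| * N x
  cont : Continuous N
  bdd : ∀ x, ‖x‖ ≤ N x
  upper : ∃ C : NNReal, ∀ x, N x ≤ C * ‖x‖

lemma pNorm_eq {d : ℕ} (p : ℝ≥0∞) (hp : 1 ≤ p) (x : Fin d → ℝ) :
    pNorm p x = ‖WithLp.toLp p x‖ := by
  unfold pNorm
  split_ifs with h
  · subst h
    rw [PiLp.norm_eq_ciSup]
    rfl
  · have : 0 < p.toReal := ENNReal.toReal_pos (by positivity) h
    rw [PiLp.norm_eq_sum this]
    rfl

lemma goodNorm_pNorm {d : ℕ} (p : ℝ≥0∞) (hp : 1 ≤ p) : GoodNorm (pNorm (d := d) p) := by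
  have : Fact (1 ≤ p) := ⟨hp⟩
  have e : pNorm (d := d) p = fun x => ‖WithLp.toLp p x‖ := funext (pNorm_eq p hp)
  rw [e]
  refine ⟨fun x y => ?_, fun c x => ?_, ?_, fun x => ?_, ?_⟩
  · rw [WithLp.toLp_add]; exact norm_add_le _ _
  · rw [WithLp.toLp_smul, norm_smul, Real.norm_eq_abs]
  · fun_prop
  · refine (pi_norm_le_iff_of_nonneg (norm_nonneg _)).2 fun i => ?_
    exact PiLp.norm_apply_le (WithLp.toLp p x) i
  · refine ⟨‖((PiLp.continuousLinearEquiv p ℝ (fun _ : Fin d => ℝ)).symm :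
      (Fin d → ℝ) →L[ℝ] PiLp p (fun _ : Fin d => ℝ))‖₊, fun x => ?_⟩
    exact ContinuousLinearMap.le_opNorm ((PiLp.continuousLinearEquiv p ℝ (fun _ : Fin d => ℝ)).symm :
      (Fin d → ℝ) →L[ℝ] PiLp p (fun _ : Fin d => ℝ)) x

namespace GoodNorm
variable {d : ℕ} {N : (Fin d → ℝ) → ℝ}

lemma nonneg (h : GoodNorm N) (x : Fin d → ℝ) : 0 ≤ N x := (norm_nonneg _).trans (h.bdd x)

lemma zero (h : GoodNorm N) : N 0 = 0 := by simpa using h.smul 0 0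

lemma sub_comm (h : GoodNorm N) (x y : Fin d → ℝ) : N (x - y) = N (y - x) := by
  have := h.smul (-1) (y - x)
  simpa using this

lemma closed (h : GoodNorm N) (c : Fin d → ℝ) (r : ℝ) : IsClosed {w | N (w - c) ≤ r} :=
  isClosed_le (h.cont.comp (continuous_id.sub continuous_const)) continuous_const

lemma compact (h : GoodNorm N) (c : Fin d → ℝ) (r : ℝ) : IsCompact {w | N (w - c) ≤ r} := by
  refine (isCompact_closedBall c r).of_isClosed_subset (h.closed c r) fun w hw => ?_
  rw [mem_closedBall_iff_norm]
  exact (h.bdd _).trans hw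

lemma vol (h : GoodNorm N) (c : Fin d → ℝ) {r : ℝ} (hr : 0 < r) :
    volume.real {w | N (w - c) ≤ r} = r ^ d * volume.real {w | N w ≤ 1} := by
  have e : {w | N (w - c) ≤ r} =
      (fun w => w + (-c)) ⁻¹' ((fun w => r⁻¹ • w) ⁻¹' {w | N w ≤ 1}) := by
    ext w
    simp only [Set.mem_setOf_eq, Set.mem_preimage, h.smul, ← sub_eq_add_neg]
    rw [abs_of_pos (inv_pos.2 hr), inv_mul_le_iff₀ hr, mul_one]
  rw [e, measureReal_def, measure_preimage_add_right,
    Measure.addHaar_preimage_smul _ (inv_pos.2 hr).ne', ENNReal.toReal_mul, measureReal_def,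
    ENNReal.toReal_ofReal (abs_nonneg _), abs_of_pos (by positivity)]
  simp

lemma vol_pos (h : GoodNorm N) {r : ℝ} (hr : 0 < r) : 0 < volume.real {w | N w ≤ r} := by
  have hfin : volume {w | N w ≤ r} ≠ ∞ := by
    simpa using (h.compact 0 r).measure_lt_top.ne
  refine ENNReal.toReal_pos ?_ hfin
  have ho : IsOpen {w | N w < r} := isOpen_lt h.cont continuous_const
  have hp : 0 < volume {w | N w < r} := ho.measure_pos _ ⟨0, by simpa [h.zero] using hr⟩
  exact (hp.trans_le (measure_mono fun w (hw : N w < r) => hw.le)).ne'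

lemma key (h : GoodNorm N) (hd : 1 ≤ d) {β : ℝ} (hβ : 0 < β) (g : (Fin d → ℝ) → ℝ)
    (hg : Measurable g) (M : ℝ) (hM : ∀ x, |g x| ≤ M) (x y : Fin d → ℝ) :
    |(∫ v in {v | N v ≤ β}, g (x + v)) - ∫ v in {v | N v ≤ β}, g (y + v)| ≤
      M * volume.real {w | N w ≤ β} * (d * N (x - y) / β) := by
  have hM0 : 0 ≤ M := (abs_nonneg _).trans (hM 0)
  have hd' : (1 : ℝ) ≤ d := by exact_mod_cast hd
  have tr : ∀ c : Fin d → ℝ, (∫ v in {v | N v ≤ β}, g (c + v)) = ∫ w in {w | N (w - c) ≤ β}, g w := by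
    intro c
    have := (measurePreserving_add_left (volume : Measure (Fin d → ℝ)) c).setIntegral_preimage_emb
      (measurableEmbedding_addLeft c) g {w | N (w - c) ≤ β}
    rw [← this]
    congr 2
    ext v
    simp
  have V : ∀ c : Fin d → ℝ, volume.real {w | N (w - c) ≤ β} = volume.real {w | N w ≤ β} := by
    intro c
    have := h.vol 0 hβ
    simp only [sub_zero] at this
    rw [h.vol c hβ, this]
  have int : ∀ (c : Fin d → ℝ) (r : ℝ), IntegrableOn g {w | N (w - c) ≤ r} := by
    intro c r
    exact Measure.integrableOn_of_bounded (h.compact c r).measure_lt_top.ne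
      hg.aestronglyMeasurable (M := M) (ae_of_all _ hM)
  rw [tr, tr]
  by_cases hb : 2 * β ≤ N (x - y)
  · have b : ∀ c : Fin d → ℝ, |∫ w in {w | N (w - c) ≤ β}, g w| ≤ M * volume.real {w | N w ≤ β} := by
      intro c
      rw [← V c]
      exact abs_setInt_le _ _ _ (h.compact c β).measure_lt_top hM
    have h2 : 2 ≤ d * N (x - y) / β := by
      rw [le_div_iff₀ hβ]
      nlinarith
    have h3 : 0 ≤ M * volume.real {w | N w ≤ β} := mul_nonneg hM0 measureReal_nonneg
    refine (abs_sub _ _).trans ?_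
    nlinarith [b x, b y]
  · push Not at hb
    set s := N (x - y) with hs
    have hs0 : 0 ≤ s := h.nonneg _
    set m : Fin d → ℝ := (1/2 : ℝ) • (x + y) with hm
    set K := {w | N (w - m) ≤ β - s / 2} with hK
    have hr : 0 < β - s / 2 := by linarith
    have half : ∀ a b : Fin d → ℝ, N (a - b) = s → m = (1/2 : ℝ) • (a + b) →
        K ⊆ {w | N (w - a) ≤ β} := by
      intro a b hab hmab w hw
      have e : w - a = (w - m) + (1/2 : ℝ) • (b - a) := by
        rw [hmab]; ext i; simp; ring
      have h1 := h.tri (w - m) ((1/2 : ℝ) • (b - a))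
      rw [← e, h.smul, h.sub_comm b a, hab, abs_of_pos (by norm_num)] at h1
      have : N (w - m) ≤ β - s / 2 := hw
      show N (w - a) ≤ β
      linarith
    have volK : volume.real K = (1 - s / (2 * β)) ^ d * volume.real {w | N w ≤ β} := by
      have e2 := h.vol 0 hβ
      simp only [sub_zero] at e2
      rw [hK, h.vol m hr, e2, ← mul_assoc, ← mul_pow]
      congr 2
      field_simp
    have bern : 1 - d * (s / (2 * β)) ≤ (1 - s / (2 * β)) ^ d := by
      have h1 : s / (2 * β) ≤ 1 := by rw [div_le_one (by positivity)]; exact hb.le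
      have := one_add_mul_le_pow (a := -(s / (2 * β))) (by linarith) d
      calc _ = 1 + (d : ℝ) * -(s / (2 * β)) := by ring
        _ ≤ _ := this
        _ = _ := by ring
    have est : ∀ a : Fin d → ℝ, K ⊆ {w | N (w - a) ≤ β} →
        |(∫ w in {w | N (w - a) ≤ β}, g w) - ∫ w in K, g w| ≤
          M * volume.real {w | N w ≤ β} * (d * (s / (2 * β))) := by
      intro a ha
      rw [← setIntegral_sdiff (h.closed m _).measurableSet (int a β) ha]
      refine (abs_setInt_le _ _ M ?_ hM).trans ?_
      · exact (measure_mono Set.diff_subset).trans_lt (h.compact a β).measure_lt_top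
      · rw [measureReal_diff ha (h.closed m _).measurableSet
          (h.compact a β).measure_lt_top.ne, V, volK, mul_assoc]
        refine mul_le_mul_of_nonneg_left ?_ hM0
        have : 0 ≤ volume.real {w | N w ≤ β} := measureReal_nonneg
        nlinarith
    have e1 := est x (half x y rfl rfl)
    have e2 := est y (half y x (h.sub_comm y x) (by rw [hm, add_comm]))
    have : M * volume.real {w | N w ≤ β} * (d * s / β) =
      M * volume.real {w | N w ≤ β} * (d * (s / (2 * β))) +
      M * volume.real {w | N w ≤ β} * (d * (s / (2 * β))) := by field_simp; ring
    rw [this]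
    refine (abs_sub_le _ (∫ w in K, g w) _).trans (add_le_add e1 ?_)
    rw [abs_sub_comm]; exact e2

end GoodNorm

lemma dual_bound {d : ℕ} (p : ℝ≥0∞) (hp : 1 ≤ p) (a : Fin d → ℝ) (C : ℝ) (hC : 0 ≤ C)
    (h : ∀ u, |∑ i, u i * a i| ≤ C * pNorm p u) : pNorm (1 - 1 / p)⁻¹ a ≤ C := by
  have key : ∀ t : Fin d → ℝ, pNorm p t ≤ 1 → (∑ i, t i * a i) ≤ C := fun t ht =>
    (le_abs_self _).trans ((h t).trans (mul_le_of_le_one_right hC ht))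
  rcases eq_or_ne p ∞ with rfl | hpt
  · have : ∑ i, |a i| ≤ C := by
      have := key (fun i => SignType.sign (a i)) (by
        simp only [pNorm, if_true]
        refine Real.iSup_le (fun i => ?_) zero_le_one
        rcases lt_trichotomy (a i) 0 with h | h | h <;> simp [h])
      simpa [sign_mul_self] using this
    simpa [pNorm] using this
  rcases eq_or_ne p 1 with rfl | hp1
  · simp only [pNorm, div_one, tsub_self, ENNReal.inv_zero, if_true]
    refine Real.iSup_le (fun i => ?_) hC
    have := key (Pi.single i (SignType.sign (a i))) (by
      simp only [pNorm, ENNReal.one_ne_top, if_false, ENNReal.toReal_one, Real.rpow_one, div_one]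
      rw [Finset.sum_eq_single i]
      · rcases lt_trichotomy (a i) 0 with h | h | h <;> simp [h]
      · intro j _ hj; simp [hj]
      · simp)
    rw [Finset.sum_eq_single i] at this
    · simpa [sign_mul_self] using this
    · intro j _ hj; simp [hj]
    · simp
  have hlt : 1 < p := lt_of_le_of_ne hp hp1.symm
  have hpr : 1 < p.toReal := by
    rw [← ENNReal.toReal_one]
    exact (ENNReal.toReal_lt_toReal ENNReal.one_ne_top hpt).2 hlt
  have hp0 : p ≠ 0 := by positivity
  have hq : ((1 - 1 / p)⁻¹).toReal = (1 - 1 / p.toReal)⁻¹ := by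
    rw [ENNReal.toReal_inv, ENNReal.toReal_sub_of_le _ ENNReal.one_ne_top]
    · simp
    · simpa using hp
  have hqt : (1 - 1 / p)⁻¹ ≠ ∞ := by
    rw [ne_eq, ENNReal.inv_eq_top, tsub_eq_zero_iff_le, not_le]
    simpa using hlt
  have hconj : (p.toReal).HolderConjugate (1 - 1 / p.toReal)⁻¹ := by
    rw [Real.holderConjugate_iff]
    refine ⟨hpr, ?_⟩
    simp
  obtain ⟨g, hg, hgs⟩ := (NNReal.isGreatest_Lp Finset.univ (fun i => ‖a i‖₊) hconj.symm).1
  have hg' : ∑ i, (g i : ℝ) ^ p.toReal ≤ 1 := by exact_mod_cast hg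
  have hgs' : ∑ i, |a i| * (g i : ℝ) =
      (∑ i, |a i| ^ (1 - 1 / p.toReal)⁻¹) ^ (1 / (1 - 1 / p.toReal)⁻¹) := by
    have := congrArg NNReal.toReal hgs
    push_cast at this
    simpa using this
  unfold pNorm
  rw [if_neg hqt, hq, ← hgs']
  have := key (fun i => SignType.sign (a i) * g i) (by
    unfold pNorm
    rw [if_neg hpt]
    refine Real.rpow_le_one (Finset.sum_nonneg fun i _ => by positivity) ?_ (by positivity)
    refine (Finset.sum_le_sum fun i _ => ?_).trans hg'
    refine Real.rpow_le_rpow (abs_nonneg _) ?_ (by positivity)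
    rcases lt_trichotomy (a i) 0 with h | h | h <;> simp [h])
  refine le_trans (le_of_eq ?_) this
  refine Finset.sum_congr rfl fun i _ => ?_
  rw [← sign_mul_self (a i)]; ring

theorem stmt11 {d : ℕ} (hd : 1 ≤ d) (p : ℝ≥0∞) (hp : 1 ≤ p)
    (G β : ℝ) (hG : 0 < G) (hβ : 0 < β)
    (f : (Fin d → ℝ) → ℝ)
    (hf : ∀ x y, |f x - f y| ≤ G * pNorm p (x - y)) :
    (∀ x y, |smoothing p β f x - smoothing p β f y| ≤ G * pNorm p (x - y)) ∧
    Differentiable ℝ (smoothing p β f) ∧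
    (∀ x y, pNorm (1 - 1 / p)⁻¹ (grad (smoothing p β f) x - grad (smoothing p β f) y) ≤
      (d * G / β) * pNorm p (x - y)) := by
  have hN : GoodNorm (pNorm (d := d) p) := goodNorm_pNorm p hp
  set N := pNorm (d := d) p with hNdef
  set A := {v : Fin d → ℝ | N v ≤ β} with hA
  have hAc : IsCompact A := by simpa using hN.compact 0 β
  have hVpos : 0 < volume.real A := hN.vol_pos hβ
  have hsm : ∀ x, smoothing p β f x = (volume.real A)⁻¹ * ∫ v in A, f (x + v) := by
    intro x
    unfold smoothing
    rw [setAverage_eq]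
    rfl
  obtain ⟨C, hCN⟩ := hN.upper
  have hlip : LipschitzWith (Real.toNNReal G * C) f := by
    refine LipschitzWith.of_dist_le_mul fun x y => ?_
    rw [Real.dist_eq, dist_eq_norm]
    refine (hf x y).trans ?_
    rw [NNReal.coe_mul, Real.coe_toNNReal _ hG.le, mul_assoc]
    exact mul_le_mul_of_nonneg_left (hCN _) hG.le
  have hfc : Continuous f := hlip.continuous
  have hint : ∀ x, IntegrableOn (fun v => f (x + v)) A := fun x =>
    (hfc.comp (continuous_const.add continuous_id)).continuousOn.integrableOn_compact hAc
  have : IsFiniteMeasure (volume.restrict A) := ⟨by simpa using hAc.measure_lt_top⟩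
  have hder : ∀ x, Integrable (fun v => fderiv ℝ f (x + v)) (volume.restrict A) ∧
      HasFDerivAt (fun x => ∫ v in A, f (x + v)) (∫ v in A, fderiv ℝ f (x + v)) x := by
    intro x
    refine hasFDerivAt_integral_of_dominated_loc_of_lip (s := Set.univ)
      (F := fun x v => f (x + v)) (bound := fun _ => ((Real.toNNReal G * C : NNReal) : ℝ))
      Filter.univ_mem ?_ (hint x) ?_ ?_ (integrable_const _) ?_
    · exact Filter.Eventually.of_forall fun y => (hint y).aestronglyMeasurable
    · exact ((measurable_fderiv ℝ f).comp (measurable_const_add x)).aestronglyMeasurable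
    · refine ae_of_all _ fun v => ?_
      rw [Real.nnabs_coe, lipschitzOnWith_univ]
      refine LipschitzWith.of_dist_le_mul fun y z => ?_
      simpa using hlip.dist_le_mul (y + v) (z + v)
    · have h1 : ∀ᵐ v : Fin d → ℝ, DifferentiableAt ℝ f (x + v) :=
        (measurePreserving_add_left volume x).quasiMeasurePreserving.ae
          hlip.ae_differentiableAt
      filter_upwards [ae_restrict_of_ae h1] with v hv
      have := hv.hasFDerivAt.comp x ((hasFDerivAt_id x).add_const v)
      rw [ContinuousLinearMap.comp_id] at this
      exact this
  have hder' : ∀ x, HasFDerivAt (smoothing p β f)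
      ((volume.real A)⁻¹ • ∫ v in A, fderiv ℝ f (x + v)) x := by
    intro x
    have e : smoothing p β f = fun x => (volume.real A)⁻¹ * ∫ v in A, f (x + v) := funext hsm
    rw [e]
    exact (hder x).2.const_mul _
  have hfb : ∀ z u, |fderiv ℝ f z u| ≤ G * N u := by
    intro z u
    by_cases hz : DifferentiableAt ℝ f z
    · have h1 := (hz.hasFDerivAt.hasLineDerivAt u)
      have h2 := (HasDerivAt.tendsto_slope_zero h1).abs
      refine le_of_tendsto h2 ?_
      filter_upwards [self_mem_nhdsWithin] with t ht
      have ht' : (t : ℝ) ≠ 0 := ht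
      have h3 := hf (z + t • u) z
      rw [add_sub_cancel_left, hN.smul] at h3
      simp only [zero_add, zero_smul, add_zero, smul_eq_mul, abs_mul, abs_inv]
      rw [inv_mul_le_iff₀ (abs_pos.2 ht')]
      linarith
    · rw [fderiv_zero_of_not_differentiableAt hz]
      simpa using mul_nonneg hG.le (hN.nonneg u)
  refine ⟨fun x y => ?_, fun x => (hder' x).differentiableAt, fun x y => ?_⟩
  · rw [hsm, hsm, ← mul_sub, ← integral_sub (hint x) (hint y), abs_mul,
      abs_of_pos (inv_pos.2 hVpos), inv_mul_le_iff₀ hVpos, mul_comm]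
    refine abs_setInt_le _ _ _ hAc.measure_lt_top fun v => ?_
    simpa using hf (x + v) (y + v)
  · refine dual_bound p hp _ _ (mul_nonneg (by positivity) (hN.nonneg _)) fun u => ?_
    have hgr : ∀ z, ∑ i, u i * grad (smoothing p β f) z i =
        (volume.real A)⁻¹ * ∫ v in A, fderiv ℝ f (z + v) u := by
      intro z
      have e1 : ∑ i, u i * grad (smoothing p β f) z i = fderiv ℝ (smoothing p β f) z u := by
        conv_rhs => rw [pi_eq_sum_univ' u]
        simp only [map_sum, map_smul, smul_eq_mul, grad]
      rw [e1, (hder' z).fderiv, ContinuousLinearMap.smul_apply,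
        ContinuousLinearMap.integral_apply (hder z).1, smul_eq_mul]
    simp only [Pi.sub_apply, mul_sub, Finset.sum_sub_distrib]
    rw [hgr, hgr, ← mul_sub, abs_mul, abs_of_pos (inv_pos.2 hVpos), inv_mul_le_iff₀ hVpos]
    refine (hN.key hd hβ (fun z => fderiv ℝ f z u) (measurable_fderiv_apply_const ℝ f u)
      (G * N u) (fun z => hfb z u) x y).trans (le_of_eq ?_)
    rw [← hA, ← hNdef]
    ring
end
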